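/- Let u be an arbitrary word and v, w nonempty words over V. Then u ↖ (vw) = Σ_{u=u¹u²} (u¹ ≺ v)(u² ↗ w), where vw and the juxtaposition on the right denote concatenation and the sum runs over all cuts of u (with the empty-word conventions for the quadri-algebra operations). -/

import Mathlib

open Finset MonoidAlgebra TensorProduct

/-- `Sh(p,q)`: permutations of the `p+q` indices that are increasing on the
first `p` indices and on the last `q` indices. -/
def IsSh (p q : ℕ) (σ : Equiv.Perm (Fin (p + q))) : Prop :=
  (∀ i j : Fin (p + q), (i : ℕ) < (j : ℕ) → (j : ℕ) < p → σ i < σ j) ∧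
  (∀ i j : Fin (p + q), p ≤ (i : ℕ) → (i : ℕ) < (j : ℕ) → σ i < σ j)

instance IsSh.decPred (p q : ℕ) : DecidablePred (IsSh p q) := fun _ => by
  unfold IsSh; infer_instance

/-- The word `u_{σ⁻¹(1)} u_{σ⁻¹(2)} ⋯ u_{σ⁻¹(p+q)}` where `u₁ ⋯ u_p` is `u` and
`u_{p+1} ⋯ u_{p+q}` is `v`. -/
def shWord {V : Type*} (u v : List V) (σ : Equiv.Perm (Fin (u.length + v.length))) :
    FreeMonoid V :=
  FreeMonoid.ofList
    (List.ofFn fun i => (u ++ v).get (Fin.cast (@List.length_append _ u v).symm (σ.symm i)))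

/-- `posCond p b i` says that the letter at (combined) index `i` comes from the second
word (`b = true`, i.e. `p ≤ i`) or from the first word (`b = false`, i.e. `i < p`). -/
def posCond (p : ℕ) (b : Bool) (i : ℕ) : Prop :=
  match b with
  | true => p ≤ i
  | false => i < p

instance posCond.dec (p : ℕ) (b : Bool) (i : ℕ) : Decidable (posCond p b i) := by
  cases b <;> unfold posCond <;> infer_instance

variable (k : Type*) [CommRing k] {V : Type*}

/-- The shuffle product `u ⧢ v` of two words, as an element of the monoid algebra
`H` of the free monoid on `V` (sum over all `(p,q)`-shuffles); in particular
`1 ⧢ a = a ⧢ 1 = a`. -/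
noncomputable def shuffleProd (u v : List V) : MonoidAlgebra k (FreeMonoid V) :=
  ∑ σ ∈ univ.filter (IsSh u.length v.length),
    MonoidAlgebra.single (shWord u v σ) (1 : k)

/-- Generic quadri-algebra operation on words: the part of the shuffle product `u ⧢ v`
consisting of the shuffles where the first (resp. last) letter comes from `v` iff `fb`
(resp. `lb`) is `true`.  (For a shuffle permutation, the first letter comes from `v`
iff `σ⁻¹(1) = p+1`, and from `u` iff `σ⁻¹(1) = 1`; the last letter comes from `v` iff
`σ⁻¹(p+q) = p+q`, and from `u` iff `σ⁻¹(p+q) = p`.)  This definition also encodes the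
empty-word conventions: `1 ↘ a = a` and `a ↖ 1 = a` for nonempty `a`, and all other
quadri-algebra operations with an empty argument are `0`. -/
noncomputable def quadOp (fb lb : Bool) (u v : List V) : MonoidAlgebra k (FreeMonoid V) :=
  ∑ σ ∈ univ.filter (fun σ : Equiv.Perm (Fin (u.length + v.length)) =>
      IsSh u.length v.length σ ∧
      ∃ h : 0 < u.length + v.length,
        posCond u.length fb (σ.symm ⟨0, h⟩) ∧
        posCond u.length lb (σ.symm ⟨u.length + v.length - 1, Nat.sub_lt h Nat.one_pos⟩)),
    MonoidAlgebra.single (shWord u v σ) (1 : k)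

/-- `u ↘ v` : shuffles whose first and last letters come from `v`. -/
noncomputable def seOp (u v : List V) : MonoidAlgebra k (FreeMonoid V) := quadOp k true true u v

/-- `u ↗ v` : shuffles whose first letter comes from `v` and last letter from `u`. -/
noncomputable def neOp (u v : List V) : MonoidAlgebra k (FreeMonoid V) := quadOp k true false u v

/-- `u ↖ v` : shuffles whose first and last letters come from `u`. -/
noncomputable def nwOp (u v : List V) : MonoidAlgebra k (FreeMonoid V) := quadOp k false false u v

/-- `u ↙ v` : shuffles whose first letter comes from `u` and last letter from `v`. -/
noncomputable def swOp (u v : List V) : MonoidAlgebra k (FreeMonoid V) := quadOp k false true u v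

/-- `u ≻ v := u ↗ v + u ↘ v`. -/
noncomputable def succOp (u v : List V) : MonoidAlgebra k (FreeMonoid V) := neOp k u v + seOp k u v

/-- `u ≺ v := u ↖ v + u ↙ v`. -/
noncomputable def precOp (u v : List V) : MonoidAlgebra k (FreeMonoid V) := nwOp k u v + swOp k u v

/-- `u ∨ v := u ↘ v + u ↙ v`. -/
noncomputable def veeOp (u v : List V) : MonoidAlgebra k (FreeMonoid V) := seOp k u v + swOp k u v

/-- `u ∧ v := u ↗ v + u ↖ v`. -/
noncomputable def wedgeOp (u v : List V) : MonoidAlgebra k (FreeMonoid V) := neOp k u v + nwOp k u v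

/-- Merge two words along a mask (`true` = take from second word). -/
def mergeMask {V : Type*} : List Bool → List V → List V → List V
  | [], _, _ => []
  | true :: m, u, v => v.take 1 ++ mergeMask m u (v.drop 1)
  | false :: m, u, v => u.take 1 ++ mergeMask m (u.drop 1) v

theorem mergeMask_append {V : Type*} (m n : List Bool) (u u' v v' : List V)
    (hu : m.count false = u.length) (hv : m.count true = v.length) :
    mergeMask (m ++ n) (u ++ u') (v ++ v') = mergeMask m u v ++ mergeMask n u' v' := by
  induction m generalizing u v with
  | nil =>
    simp at hu hv
    have := List.eq_nil_of_length_eq_zero hu.symm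
    have := List.eq_nil_of_length_eq_zero hv.symm
    subst_vars; simp [mergeMask]
  | cons b m ih =>
    cases b
    · cases u with
      | nil => simp at hu
      | cons a u => simp at hu hv; simp [mergeMask, ih u v hu hv]
    · cases v with
      | nil => simp at hv
      | cons a v => simp at hu hv; simp [mergeMask, ih u v hu hv]

theorem mergeMask_length {V : Type*} (m : List Bool) (u v : List V)
    (hu : m.count false = u.length) (hv : m.count true = v.length) :
    (mergeMask m u v).length = m.length := by
  induction m generalizing u v with
  | nil => simp [mergeMask]
  | cons b m ih =>
    cases b
    · cases u with
      | nil => simp at hu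
      | cons a u => simp at hu hv; simp [mergeMask, ih u v hu hv]
    · cases v with
      | nil => simp at hv
      | cons a v => simp at hu hv; simp [mergeMask, ih u v hu hv]

theorem mergeMask_getElem? {V : Type*} (m : List Bool) (u v : List V)
    (hu : m.count false = u.length) (hv : m.count true = v.length) (i : ℕ) (hi : i < m.length) :
    (mergeMask m u v)[i]? = if m.get ⟨i, hi⟩ = true then v[(m.take i).count true]?
      else u[(m.take i).count false]? := by
  induction m generalizing u v i with
  | nil => simp at hi
  | cons b m ih =>
    cases b
    · cases u with
      | nil => simp at hu
      | cons a u =>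
        simp at hu hv
        cases i with
        | zero => simp [mergeMask]
        | succ i => simp at hi; simp [mergeMask, ih u v hu hv i hi]
    · cases v with
      | nil => simp at hv
      | cons a v =>
        simp at hu hv
        cases i with
        | zero => simp [mergeMask]
        | succ i => simp at hi; simp [mergeMask, ih u v hu hv i hi]

theorem count_take_ofFn {n : ℕ} (f : Fin n → Bool) (b : Bool) (i : ℕ) (hi : i ≤ n) :
    ((List.ofFn f).take i).count b = (univ.filter fun j : Fin n => (j : ℕ) < i ∧ f j = b).card := by
  induction i with
  | zero => simp
  | succ i ih =>
    have h : i < n := hi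
    have e : (univ.filter fun j : Fin n => (j : ℕ) < i + 1 ∧ f j = b) =
        (univ.filter fun j : Fin n => (j : ℕ) < i ∧ f j = b) ∪
          (if f ⟨i, h⟩ = b then {⟨i, h⟩} else ∅) := by
      ext j
      rcases lt_trichotomy (j : ℕ) i with hj | hj | hj
      · split_ifs <;> simp [Fin.ext_iff] <;> grind
      · have : j = ⟨i, h⟩ := Fin.ext hj
        subst this
        split_ifs <;> simp_all
      · split_ifs <;> simp [Fin.ext_iff] <;> grind
    rw [e, Finset.card_union_of_disjoint, List.take_add_one, List.count_append, ih h.le]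
    · congr 1
      simp [List.getElem?_ofFn, h]
      split_ifs <;> simp_all
    · split_ifs <;> simp

/-- The mask of a permutation. -/
def maskOf {p q : ℕ} (σ : Equiv.Perm (Fin (p + q))) : List Bool :=
  List.ofFn fun i => decide (p ≤ (σ.symm i : ℕ))

theorem maskOf_length {p q : ℕ} (σ : Equiv.Perm (Fin (p + q))) : (maskOf σ).length = p + q := by
  simp [maskOf]

theorem maskOf_rank_false {p q : ℕ} (σ : Equiv.Perm (Fin (p + q))) (hσ : IsSh p q σ)
    (i : Fin (p + q)) (hi : (σ.symm i : ℕ) < p) :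
    ((maskOf σ).take i).count false = σ.symm i := by
  rw [maskOf, count_take_ofFn _ _ _ i.2.le]
  have : (univ.filter fun j : Fin (p + q) => (j : ℕ) < i ∧ decide (p ≤ (σ.symm j : ℕ)) = false)
      = (Finset.Iio (σ.symm i)).map σ.toEmbedding := by
    ext j
    obtain ⟨j, rfl⟩ := σ.surjective j
    obtain ⟨i, rfl⟩ := σ.surjective i
    simp at hi ⊢
    constructor
    · rintro ⟨h1, h2⟩
      by_contra h
      rcases (not_lt.1 h).eq_or_lt with h | h
      · subst h; simp at h1
      · exact absurd h1 (hσ.1 i j h h2).not_gt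
    · intro h
      exact ⟨hσ.1 j i h hi, lt_trans h hi⟩
  rw [this]; simp

theorem maskOf_rank_true {p q : ℕ} (σ : Equiv.Perm (Fin (p + q))) (hσ : IsSh p q σ)
    (i : Fin (p + q)) (hi : p ≤ (σ.symm i : ℕ)) :
    p + ((maskOf σ).take i).count true = σ.symm i := by
  rw [maskOf, count_take_ofFn _ _ _ i.2.le]
  have : (univ.filter fun j : Fin (p + q) => (j : ℕ) < i ∧ decide (p ≤ (σ.symm j : ℕ)) = true)
      = (Finset.Ico (⟨p, lt_of_le_of_lt hi (Fin.is_lt _)⟩) (σ.symm i)).map σ.toEmbedding := by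
    ext j
    obtain ⟨j, rfl⟩ := σ.surjective j
    obtain ⟨i, rfl⟩ := σ.surjective i
    simp [Fin.le_def] at hi ⊢
    constructor
    · rintro ⟨h1, h2⟩
      refine ⟨h2, ?_⟩
      by_contra h
      rcases (not_lt.1 h).eq_or_lt with h | h
      · subst h; simp at h1
      · exact absurd h1 (hσ.2 i j hi h).not_gt
    · rintro ⟨h2, h⟩
      exact ⟨hσ.2 j i h2 h, h2⟩
  rw [this]; simp; omega

theorem maskOf_count_false {p q : ℕ} (σ : Equiv.Perm (Fin (p + q))) :
    (maskOf σ).count false = p := by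
  have h := count_take_ofFn (fun i => decide (p ≤ (σ.symm i : ℕ))) false (p + q) le_rfl
  rw [List.take_of_length_le (by simp)] at h
  rw [maskOf, h]
  have : (univ.filter fun j : Fin (p + q) => (j : ℕ) < p + q ∧
      decide (p ≤ (σ.symm j : ℕ)) = false) = (univ.map (Fin.castAddEmb q)).map σ.toEmbedding := by
    ext j
    obtain ⟨j, rfl⟩ := σ.surjective j
    simp
    constructor
    · intro h; exact ⟨⟨j, h⟩, rfl⟩
    · rintro ⟨a, rfl⟩; simp
  rw [this]; simp

theorem maskOf_count_true {p q : ℕ} (σ : Equiv.Perm (Fin (p + q))) :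
    (maskOf σ).count true = q := by
  have : (maskOf σ).count false + (maskOf σ).count true = (maskOf σ).length :=
    List.count_not_add_count (maskOf σ) true
  have h2 := maskOf_count_false σ
  have h3 := maskOf_length σ
  omega

theorem maskOf_injOn {p q : ℕ} (σ τ : Equiv.Perm (Fin (p + q))) (hσ : IsSh p q σ)
    (hτ : IsSh p q τ) (h : maskOf σ = maskOf τ) : σ = τ := by
  have : σ.symm = τ.symm := by
    ext i
    have hi : decide (p ≤ (σ.symm i : ℕ)) = decide (p ≤ (τ.symm i : ℕ)) :=
      congrFun (List.ofFn_injective h) i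
    simp at hi
    by_cases hp : p ≤ (σ.symm i : ℕ)
    · rw [← maskOf_rank_true σ hσ i hp, ← maskOf_rank_true τ hτ i (hi.1 hp), h]
    · rw [← maskOf_rank_false σ hσ i (by omega), ← maskOf_rank_false τ hτ i (by omega), h]
  simpa using congrArg Equiv.symm this

theorem maskOf_surj {p q : ℕ} (m : List Bool) (hp : m.count false = p) (hq : m.count true = q) :
    ∃ σ : Equiv.Perm (Fin (p + q)), IsSh p q σ ∧ maskOf σ = m := by
  have hl : m.length = p + q := by
    have : m.count false + m.count true = m.length := List.count_not_add_count m true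
    omega
  obtain ⟨f, rfl⟩ : ∃ f : Fin (p + q) → Bool, m = List.ofFn f := by
    refine ⟨fun i => m.get ⟨i, by omega⟩, ?_⟩
    apply List.ext_getElem <;> simp [hl]
  have cnt : ∀ b, (univ.filter fun j => f j = b).card = (List.ofFn f).count b := by
    intro b
    have h := count_take_ofFn f b (p + q) le_rfl
    rw [List.take_of_length_le (by simp)] at h
    rw [h]; simp
  have h1 : (univ.filter fun j => f j = false).card = p := by rw [cnt, hp]
  have h2 : (univ.filter fun j => f j = false)ᶜ.card = q := by
    rw [Finset.compl_filter]; simp [cnt, hq]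
  let σ := finSumFinEquiv.symm.trans (finSumEquivOfFinset h1 h2)
  have s1 : ∀ j, σ (Fin.castAdd q j) = (univ.filter fun j => f j = false).orderEmbOfFin h1 j := by
    intro j; simp [σ]
  have s2 : ∀ j, σ (Fin.natAdd p j) = (univ.filter fun j => f j = false)ᶜ.orderEmbOfFin h2 j := by
    intro j; simp [σ]
  refine ⟨σ, ⟨?_, ?_⟩, ?_⟩
  · intro i j hij hj
    have ei : i = Fin.castAdd q ⟨i, by omega⟩ := rfl
    have ej : j = Fin.castAdd q ⟨j, by omega⟩ := rfl
    have := (s1 ⟨i, by omega⟩).trans_lt (lt_of_lt_of_eq ?_ (s1 ⟨j, by omega⟩).symm)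
    · rwa [← ei, ← ej] at this
    · simpa using hij
  · intro i j hi hij
    have ei : i = Fin.natAdd p ⟨i - p, by omega⟩ := by ext; simp; omega
    have ej : j = Fin.natAdd p ⟨j - p, by omega⟩ := by ext; simp; omega
    have := (s2 ⟨i - p, by omega⟩).trans_lt (lt_of_lt_of_eq ?_ (s2 ⟨j - p, by omega⟩).symm)
    · rwa [← ei, ← ej] at this
    · simp; omega
  · rw [maskOf]
    congr 1
    ext i
    obtain ⟨i, rfl⟩ := σ.surjective i
    simp
    induction i using Fin.addCases with
    | left j =>
      have := Finset.orderEmbOfFin_mem _ h1 j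
      rw [← s1] at this
      simp at this
      simp [this]
    | right j =>
      have := Finset.orderEmbOfFin_mem _ h2 j
      rw [← s2] at this
      simp at this
      simp [this]

theorem shWord_eq {V : Type*} (u v : List V) (σ : Equiv.Perm (Fin (u.length + v.length)))
    (hσ : IsSh u.length v.length σ) :
    shWord u v σ = FreeMonoid.ofList (mergeMask (maskOf σ) u v) := by
  rw [shWord]
  congr 1
  have hf := maskOf_count_false σ
  have ht := maskOf_count_true σ
  apply List.ext_getElem?
  intro i
  by_cases hi : i < u.length + v.length
  · rw [mergeMask_getElem? _ _ _ hf ht i (by rw [maskOf_length]; exact hi)]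
    have hm : (maskOf σ).get ⟨i, by rw [maskOf_length]; exact hi⟩
      = decide (u.length ≤ (σ.symm ⟨i, hi⟩ : ℕ)) := by simp [maskOf]
    rw [hm]
    simp only [List.getElem?_ofFn, hi, dif_pos, decide_eq_true_eq]
    split_ifs with hp
    · have := maskOf_rank_true σ hσ ⟨i, hi⟩ hp
      have h3 : ((maskOf σ).take i).count true = σ.symm ⟨i, hi⟩ - u.length := by
        simp at this; omega
      rw [h3, ← List.getElem?_append_right hp]
      simp
    · have := maskOf_rank_false σ hσ ⟨i, hi⟩ (by omega)
      simp only at this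
      rw [this, ← List.getElem?_append_left (l₂ := v) (by omega)]
      simp
  · rw [List.getElem?_eq_none, List.getElem?_eq_none]
    · rw [mergeMask_length _ _ _ hf ht, maskOf_length]; omega
    · simp; omega

/-- All masks with `p` times `false` and `q` times `true`. -/
def masks (p q : ℕ) : Finset (List Bool) :=
  ((univ : Finset (Fin (p + q) → Bool)).image List.ofFn).filter
    fun m => m.count false = p ∧ m.count true = q

theorem mem_masks {p q : ℕ} {m : List Bool} :
    m ∈ masks p q ↔ m.count false = p ∧ m.count true = q := by
  simp only [masks, mem_filter, mem_image, mem_univ, true_and, and_iff_right_iff_imp]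
  rintro ⟨h1, h2⟩
  obtain ⟨σ, -, h⟩ := maskOf_surj m h1 h2
  exact ⟨_, h⟩

theorem quadOp_eq (k : Type*) [CommRing k] {V : Type*} (fb lb : Bool) (u v : List V) :
    quadOp k fb lb u v = ∑ m ∈ (masks u.length v.length).filter
      (fun m => m.head? = some fb ∧ m.getLast? = some lb),
      MonoidAlgebra.single (FreeMonoid.ofList (mergeMask m u v)) (1 : k) := by
  have key : ∀ σ : Equiv.Perm (Fin (u.length + v.length)),
      ((maskOf σ).head? = some fb ∧ (maskOf σ).getLast? = some lb) ↔
      ∃ h : 0 < u.length + v.length,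
        posCond u.length fb (σ.symm ⟨0, h⟩) ∧
        posCond u.length lb (σ.symm ⟨u.length + v.length - 1, Nat.sub_lt h Nat.one_pos⟩) := by
    intro σ
    by_cases h : 0 < u.length + v.length
    · have pc : ∀ (b : Bool) (i : ℕ), posCond u.length b i ↔ decide (u.length ≤ i) = b := by
        intro b i; cases b <;> simp [posCond]
      rw [List.head?_eq_getElem?, List.getLast?_eq_getElem?, maskOf_length]
      simp only [maskOf, List.getElem?_ofFn, pc, h, Nat.sub_lt h Nat.one_pos, dif_pos,
        Option.some.injEq, exists_true_left]
    · have h0 : maskOf σ = [] := List.eq_nil_of_length_eq_zero (by rw [maskOf_length]; omega)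
      simp [h0, h]
  rw [quadOp]
  refine Finset.sum_bij (fun σ _ => maskOf σ) ?_ ?_ ?_ ?_
  · intro σ hσ
    rw [mem_filter] at hσ ⊢
    exact ⟨mem_masks.2 ⟨maskOf_count_false σ, maskOf_count_true σ⟩, (key σ).2 hσ.2.2⟩
  · intro σ hσ τ hτ h
    rw [mem_filter] at hσ hτ
    exact maskOf_injOn σ τ hσ.2.1 hτ.2.1 h
  · intro m hm
    rw [mem_filter, mem_masks] at hm
    obtain ⟨σ, h1, h2⟩ := maskOf_surj m hm.1.1 hm.1.2
    refine ⟨σ, ?_, h2⟩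
    rw [mem_filter]
    exact ⟨mem_univ _, h1, (key σ).1 (h2 ▸ hm.2)⟩
  · intro σ hσ
    rw [mem_filter] at hσ
    rw [shWord_eq _ _ _ hσ.2.1]

theorem precOp_eq (k : Type*) [CommRing k] {V : Type*} (u v : List V) :
    precOp k u v = ∑ m ∈ (masks u.length v.length).filter (fun m => m.head? = some false),
      MonoidAlgebra.single (FreeMonoid.ofList (mergeMask m u v)) (1 : k) := by
  rw [precOp, nwOp, swOp, quadOp_eq, quadOp_eq, ← Finset.sum_union]
  · congr 1
    ext m
    rw [mem_union, mem_filter, mem_filter, mem_filter]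
    rcases m.eq_nil_or_concat with rfl | ⟨l, b, rfl⟩
    · simp
    · cases b <;> simp
  · rw [Finset.disjoint_left]
    intro m h1 h2
    rw [mem_filter] at h1 h2
    have := h1.2.2.symm.trans h2.2.2
    simp at this

theorem split_exists (m : List Bool) (q : ℕ) (h : q < m.count true) :
    ∃ a b, m = a ++ true :: b ∧ a.count true = q := by
  induction m generalizing q with
  | nil => simp at h
  | cons c m ih =>
    cases c
    · simp at h
      obtain ⟨a, b, rfl, h'⟩ := ih q h
      exact ⟨false :: a, b, by simp, by simpa using h'⟩
    · cases q with
      | zero => exact ⟨[], m, by simp, by simp⟩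
      | succ q =>
        simp at h
        obtain ⟨a, b, rfl, h'⟩ := ih q h
        exact ⟨true :: a, b, by simp, by simpa using h'⟩

theorem split_unique (a b a' b' : List Bool) (h : a ++ true :: b = a' ++ true :: b')
    (hc : a.count true = a'.count true) : a = a' ∧ b = b' := by
  induction a generalizing a' with
  | nil =>
    cases a' with
    | nil => simpa using h
    | cons c a' => simp at h; obtain ⟨rfl, -⟩ := h; simp at hc
  | cons c a ih =>
    cases a' with
    | nil => simp at h; obtain ⟨rfl, -⟩ := h; simp at hc
    | cons c' a' =>
      simp at h
      obtain ⟨rfl, h⟩ := h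
      have := ih a' h (by cases c <;> simpa using hc)
      simp [this]

theorem statement7 (u v w : List V) (hv : v ≠ []) (hw : w ≠ []) :
    nwOp k u (v ++ w) =
      ∑ i ∈ Finset.range (u.length + 1),
        precOp k (u.take i) v * neOp k (u.drop i) w := by
  have hv' : 0 < v.length := List.length_pos_of_ne_nil hv
  have hw' : 0 < w.length := List.length_pos_of_ne_nil hw
  simp only [precOp_eq, nwOp, neOp, quadOp_eq, Finset.sum_mul_sum, ← Finset.sum_product',
    MonoidAlgebra.single_mul_single, mul_one, ← FreeMonoid.ofList_append]
  rw [Finset.sum_sigma']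
  symm
  refine Finset.sum_bij (fun x _ => x.2.1 ++ x.2.2) ?_ ?_ ?_ ?_
  · rintro ⟨i, a, b⟩ h
    simp only [mem_sigma, mem_product, mem_filter, mem_masks, mem_range, List.length_take,
      List.length_drop] at h ⊢
    obtain ⟨hi, ⟨⟨h1, h2⟩, h3⟩, ⟨h4, h5⟩, h6, h7⟩ := h
    simp only [List.count_append, List.length_append, List.head?_append, List.getLast?_append,
      h3, h7]
    refine ⟨⟨by omega, by omega⟩, by simp, by simp⟩
  · rintro ⟨i, a, b⟩ h ⟨i', a', b'⟩ h' e
    simp only [mem_sigma, mem_product, mem_filter, mem_masks, mem_range, List.length_take,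
      List.length_drop] at h h' e
    obtain ⟨hi, ⟨⟨h1, h2⟩, h3⟩, ⟨h4, h5⟩, h6, h7⟩ := h
    obtain ⟨hi', ⟨⟨h1', h2'⟩, h3'⟩, ⟨h4', h5'⟩, h6', h7'⟩ := h'
    obtain ⟨b, rfl⟩ := List.head?_eq_some_iff.1 h6
    obtain ⟨b', rfl⟩ := List.head?_eq_some_iff.1 h6'
    obtain ⟨rfl, rfl⟩ := split_unique a b a' b' e (h2.trans h2'.symm)
    have : i = i' := by omega
    subst this
    rfl
  · intro m hm
    rw [mem_filter, mem_masks, List.length_append] at hm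
    obtain ⟨⟨h1, h2⟩, h3, h4⟩ := hm
    obtain ⟨a, b, rfl, hc⟩ := split_exists m v.length (by omega)
    rw [List.count_append] at h1 h2
    refine ⟨⟨a.count false, a, true :: b⟩, ?_, rfl⟩
    simp only [mem_sigma, mem_product, mem_filter, mem_masks, mem_range, List.length_take,
      List.length_drop]
    refine ⟨by omega, ⟨⟨by omega, hc⟩, ?_⟩, ⟨by omega, by omega⟩, rfl, ?_⟩
    · cases a with
      | nil => simp at hc; omega
      | cons c a => simpa using h3
    · rw [List.getLast?_append_of_ne_nil _ (by simp)] at h4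
      exact h4
  · rintro ⟨i, a, b⟩ h
    simp only [mem_sigma, mem_product, mem_filter, mem_masks] at h
    rw [← mergeMask_append _ _ _ _ _ _ h.2.1.1.1 h.2.1.1.2, List.take_append_drop]
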